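/- arXiv:2510.11622 — 2 statements merged into one kernel-verified Lean document; each statement's English description precedes it below -/
import Mathlib

section
/- Let p be an odd prime and suppose that the multiplicative order t of 2 in (ℤ/pℤ)^× is odd. Then the ℚ-vector space of rational linear relations among the cosecant values csc(2πk/p) for k = 1, …, (p−1)/2, namely { (a_1, …, a_{(p−1)/2}) ∈ ℚ^{(p−1)/2} : Σ_{k=1}^{(p−1)/2} a_k · csc(2πk/p) = 0 }, has dimension exactly (p−1)/(2t) over ℚ. -/
/-- The ℚ-linear map `ℚ^{(p-1)/2} → ℝ` sending `(a_1, …, a_{(p-1)/2})` to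
`Σ_{k=1}^{(p-1)/2} a_k · csc(2πk/p)`, where `csc x = (sin x)⁻¹`.  The index
`k : Fin ((p-1)/2)` corresponds to the integer `k.1 + 1 ∈ {1, …, (p-1)/2}`. -/
noncomputable def cscRelationMap (p : ℕ) : (Fin ((p - 1) / 2) → ℚ) →ₗ[ℚ] ℝ :=
  ∑ k : Fin ((p - 1) / 2),
    (Real.sin (2 * Real.pi * (k.1 + 1) / p))⁻¹ •
      ((Algebra.linearMap ℚ ℝ).comp (LinearMap.proj k))

/-- Elementary bound for the difference of two negative powers, uniform in the exponent. -/
lemma abs_rpow_neg_sub_rpow_neg_le {u v s : ℝ} (hu : 0 < u) (huv : u ≤ v) (hs1 : 1 ≤ s)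
    (hs2 : s ≤ 2) :
    |v ^ (-s) - u ^ (-s)| ≤ (u⁻¹ + (u ^ 2)⁻¹) * (2 * (v - u) / v) := by
  have hv : 0 < v := hu.trans_le huv
  have hr : 0 < u / v := div_pos hu hv
  have hr1 : u / v ≤ 1 := (div_le_one hv).2 huv
  have h1 : v ^ (-s) = u ^ (-s) * (u / v) ^ s := by
    rw [Real.div_rpow hu.le hv.le, Real.rpow_neg hu.le, Real.rpow_neg hv.le]
    have := (Real.rpow_pos_of_pos hu s).ne'
    field_simp
  have h2 : (u / v) ^ (2 : ℕ) ≤ (u / v) ^ s := by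
    rw [← Real.rpow_natCast]
    exact Real.rpow_le_rpow_of_exponent_ge hr hr1 (by simpa using hs2)
  have h3 : (u / v) ^ s ≤ 1 := Real.rpow_le_one hr.le hr1 (by linarith)
  have h4 : u ^ (-s) ≤ u⁻¹ + (u ^ 2)⁻¹ := by
    rcases le_total u 1 with h | h
    · have : u ^ (-s) ≤ u ^ (-(2 : ℕ) : ℝ) :=
        Real.rpow_le_rpow_of_exponent_ge hu h (by push_cast; linarith)
      rw [Real.rpow_neg hu.le (2 : ℕ), Real.rpow_natCast] at this
      have : 0 < u⁻¹ := inv_pos.2 hu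
      linarith
    · have : u ^ (-s) ≤ u ^ (-1 : ℝ) := Real.rpow_le_rpow_of_exponent_le h (by linarith)
      rw [Real.rpow_neg_one] at this
      have : 0 < (u ^ 2)⁻¹ := by positivity
      linarith
  have h5 : 1 - (u / v) ^ s ≤ 2 * (v - u) / v := by
    have : 2 * (v - u) / v = 2 * (1 - u / v) := by field_simp
    rw [this]
    nlinarith
  have h6 : |v ^ (-s) - u ^ (-s)| = u ^ (-s) * (1 - (u / v) ^ s) := by
    rw [h1, abs_sub_comm, abs_of_nonneg]
    · ring
    · nlinarith [Real.rpow_pos_of_pos hu (-s)]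
  rw [h6]
  exact mul_le_mul h4 h5 (by linarith) (by positivity)

open HurwitzZeta in
/-- Grouping of the Dirichlet series of `hurwitzZetaOdd` in which `n` is paired with `-n`. -/
lemma hasSum_hurwitzZetaOdd_paired {a : ℝ} (ha : a ∈ Set.Ioo 0 1) {s : ℝ} (hs : 1 < s) :
    HasSum (fun n : ℕ ↦ (((n + 1 + a) ^ (-s) - (n + 1 - a) ^ (-s) : ℝ) : ℂ))
      (2 * hurwitzZetaOdd a s - ((a ^ (-s) : ℝ) : ℂ)) := by
  obtain ⟨h0, h1⟩ := ha
  have h := ((hasSum_int_hurwitzZetaOdd a (s := s) (by simpa)).nat_add_neg).mul_left 2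
  rw [← hasSum_nat_add_iff' 1] at h
  have h' := h.congr_fun
      (g := fun n : ℕ ↦ (((n + 1 + a) ^ (-s) - (n + 1 - a) ^ (-s) : ℝ) : ℂ)) fun n ↦ by
    have hn : (0 : ℝ) ≤ n := n.cast_nonneg
    have e1 : (0 : ℝ) < (n + 1 + a) := by linarith
    have e2 : -(n + 1 : ℝ) + a < 0 := by linarith
    have e3 : (0 : ℝ) < (n + 1 - a) := by linarith
    push_cast
    rw [abs_of_pos e1, abs_of_neg e2, sign_pos e1, sign_neg e2]
    rw [show -(-(n + 1 : ℝ) + a) = n + 1 - a by ring, ← Complex.ofReal_cpow e1.le,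
      ← Complex.ofReal_cpow e3.le, Real.rpow_neg e1.le, Real.rpow_neg e3.le]
    push_cast
    simp
    ring
  convert h' using 1
  · rfl
  · simp [abs_of_pos h0, sign_pos h0, Real.rpow_neg h0.le, Complex.ofReal_cpow h0.le]
    ring

open HurwitzZeta Filter Topology in
/-- The value at `1` of the odd Hurwitz zeta function. -/
lemma hurwitzZetaOdd_one {a : ℝ} (ha : a ∈ Set.Ioo 0 1) :
    hurwitzZetaOdd a 1 = Real.pi / 2 * Complex.cot (Real.pi * a) := by
  have h0 : 0 < a := ha.1
  have h1 : 0 < 1 - a := sub_pos.2 ha.2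
  have hmem : (a : ℂ) ∈ Complex.integerComplement := by
    rintro ⟨n, hn⟩
    have hn' : (n : ℝ) = a := by exact_mod_cast hn
    have : (0 : ℝ) < n ∧ (n : ℝ) < 1 := hn' ▸ ha
    have h2 : 0 < n ∧ n < 1 := by exact_mod_cast this
    omega
  have hs0 : Tendsto (fun s : ℝ ↦ s) (𝓝[>] 1) (𝓝 1) :=
    tendsto_nhdsWithin_of_tendsto_nhds tendsto_id
  have hpow {x : ℝ} (hx : 0 < x) : Tendsto (fun s : ℝ ↦ x ^ (-s)) (𝓝[>] 1) (𝓝 x⁻¹) := by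
    rw [← Real.rpow_neg_one]
    exact (tendsto_const_nhds).rpow hs0.neg (Or.inl hx.ne')
  have hL : Tendsto (fun s : ℝ ↦ 2 * hurwitzZetaOdd a s - ((a ^ (-s) : ℝ) : ℂ)) (𝓝[>] 1)
      (𝓝 (2 * hurwitzZetaOdd a 1 - ((a⁻¹ : ℝ) : ℂ))) := by
    refine Tendsto.sub (Tendsto.const_mul _ ?_)
      ((Complex.continuous_ofReal.tendsto _).comp (hpow h0))
    have := ((differentiable_hurwitzZetaOdd a).continuous.comp Complex.continuous_ofReal).tendsto 1
    simpa [Function.comp_def] using this.comp hs0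
  have hR := tendsto_tsum_of_dominated_convergence (𝓕 := 𝓝[>] (1 : ℝ))
    (f := fun s (n : ℕ) ↦ (((n + 1 + a) ^ (-s) - (n + 1 - a) ^ (-s) : ℝ) : ℂ))
    (g := fun n : ℕ ↦ (((n + 1 + a)⁻¹ - (n + 1 - a)⁻¹ : ℝ) : ℂ))
    (bound := fun n : ℕ ↦ 8 / (1 - a) ^ 2 * (1 / ((n + 1 : ℕ) : ℝ) ^ 2)) ?_ ?_ ?_
  · have hE : (fun s : ℝ ↦ 2 * hurwitzZetaOdd a s - ((a ^ (-s) : ℝ) : ℂ)) =ᶠ[𝓝[>] 1]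
        fun s ↦ ∑' n : ℕ, (((n + 1 + a) ^ (-s) - (n + 1 - a) ^ (-s) : ℝ) : ℂ) := by
      filter_upwards [self_mem_nhdsWithin] with s hs
      exact (hasSum_hurwitzZetaOdd_paired ha hs).tsum_eq.symm
    have hlim := tendsto_nhds_unique (hL.congr' hE) hR
    have hcot := cot_series_rep' hmem
    have hterm : ∀ n : ℕ, (((n + 1 + a)⁻¹ - (n + 1 - a)⁻¹ : ℝ) : ℂ) =
        1 / (a - (n + 1)) + 1 / (a + (n + 1)) := by
      intro n
      push_cast
      rw [show (a : ℂ) - (n + 1) = -(n + 1 - a) by ring, one_div, one_div, inv_neg,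
        add_comm (a : ℂ)]
      ring
    rw [tsum_congr hterm, ← hcot] at hlim
    push_cast at hlim
    linear_combination hlim / 2
  · exact ((summable_nat_add_iff 1).2 (Real.summable_one_div_nat_pow.2 one_lt_two)).mul_left _
  · intro n
    have hn : (0 : ℝ) ≤ n := n.cast_nonneg
    exact (Complex.continuous_ofReal.tendsto _).comp
      ((hpow (by linarith)).sub (hpow (by linarith)))
  · have : ∀ᶠ s : ℝ in 𝓝[>] 1, s ≤ 2 :=
      (hs0.eventually (eventually_lt_nhds one_lt_two)).mono fun _ h ↦ le_of_lt h
    filter_upwards [self_mem_nhdsWithin, this] with s hs hs2 n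
    have hn : (0 : ℝ) ≤ n := n.cast_nonneg
    have hn1 : (1 : ℝ) ≤ n + 1 := by linarith
    have hu : (1 - a) * (n + 1) ≤ n + 1 - a := by nlinarith
    have hc : 0 < (1 - a) * (n + 1) := by positivity
    rw [Complex.norm_real, Real.norm_eq_abs]
    refine (abs_rpow_neg_sub_rpow_neg_le (by linarith) (by linarith) (le_of_lt hs) hs2).trans ?_
    have e1 : ((n : ℝ) + 1 - a)⁻¹ ≤ 1 / ((1 - a) ^ 2 * (n + 1)) := by
      rw [inv_eq_one_div]
      apply one_div_le_one_div_of_le (by positivity)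
      nlinarith
    have e2 : (((n : ℝ) + 1 - a) ^ 2)⁻¹ ≤ 1 / ((1 - a) ^ 2 * (n + 1)) := by
      rw [inv_eq_one_div]
      apply one_div_le_one_div_of_le (by positivity)
      calc (1 - a) ^ 2 * (n + 1) ≤ ((1 - a) * (n + 1)) ^ 2 := by
            rw [mul_pow]; gcongr; nlinarith
        _ ≤ _ := by gcongr
    have e3 : 2 * ((n : ℝ) + 1 + a - (n + 1 - a)) / (n + 1 + a) ≤ 4 / (n + 1) := by
      apply div_le_div₀ <;> linarith [ha.2]
    calc _ ≤ (1 / ((1 - a) ^ 2 * (n + 1)) + 1 / ((1 - a) ^ 2 * (n + 1))) * (4 / (n + 1 : ℝ)) := by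
          apply mul_le_mul (add_le_add e1 e2) e3 _ (by positivity)
          apply div_nonneg <;> linarith
      _ = _ := by
        push_cast
        field_simp
        norm_num

lemma ZMod.stdAddChar_apply_eq_exp {N : ℕ} [NeZero N] (j : ZMod N) :
    ZMod.stdAddChar j = Complex.exp (2 * Real.pi * Complex.I * (j.val / N : ℝ)) := by
  have := ZMod.stdAddChar_coe (N := N) j.val
  simp only [Int.cast_natCast, ZMod.natCast_zmod_val] at this
  rw [this]
  push_cast
  ring_nf

lemma ZMod.stdAddChar_ne_one {N : ℕ} [NeZero N] {j : ZMod N} (hj : j ≠ 0) :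
    (ZMod.stdAddChar j : ℂ) ≠ 1 := by
  rw [← AddChar.map_zero_eq_one (ZMod.stdAddChar (N := N))]
  exact fun h ↦ hj (ZMod.injective_stdAddChar h)

/-- The value at `1` of the odd Hurwitz zeta function at a nonzero torsion point. -/
lemma hurwitzZetaOdd_toAddCircle_one {N : ℕ} [NeZero N] {j : ZMod N} (hj : j ≠ 0) :
    HurwitzZeta.hurwitzZetaOdd (ZMod.toAddCircle j) 1 =
      Real.pi * Complex.I / 2 * (1 + 2 * (ZMod.stdAddChar j - 1)⁻¹) := by
  have hN : (0 : ℝ) < N := Nat.cast_pos.2 (NeZero.pos N)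
  have hmem : (j.val / N : ℝ) ∈ Set.Ioo (0 : ℝ) 1 :=
    ⟨div_pos (Nat.cast_pos.2 (Nat.pos_of_ne_zero ((ZMod.val_ne_zero j).2 hj))) hN,
      (div_lt_one hN).2 (Nat.cast_lt.2 (ZMod.val_lt j))⟩
  have h1 : (ZMod.stdAddChar j : ℂ) - 1 ≠ 0 := sub_ne_zero.2 (ZMod.stdAddChar_ne_one hj)
  have h2 : 1 - (ZMod.stdAddChar j : ℂ) ≠ 0 := by rwa [← neg_ne_zero, neg_sub]
  rw [ZMod.toAddCircle_apply, hurwitzZetaOdd_one hmem, Complex.cot_pi_eq_exp_ratio,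
    ← ZMod.stdAddChar_apply_eq_exp]
  have hI := Complex.I_ne_zero
  field_simp
  ring_nf
  simp only [Complex.I_sq]
  ring

/-- The character sum computing `L(1, χ)` for an odd Dirichlet character does not vanish. -/
lemma DirichletCharacter.Odd.sum_mul_inv_stdAddChar_sub_one_ne_zero {N : ℕ} [NeZero N]
    {χ : DirichletCharacter ℂ N} (hχ : χ.Odd) :
    ∑ j, χ j * (ZMod.stdAddChar j - 1)⁻¹ ≠ 0 := by
  intro h
  have hne : χ ≠ 1 := by
    rintro rfl
    have h1 : (1 : DirichletCharacter ℂ N) (-1) = -1 := hχ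
    rw [MulChar.one_apply isUnit_one.neg] at h1
    norm_num at h1
  have hodd : Function.Odd (χ : ZMod N → ℂ) := fun x ↦ hχ.eval_neg _ x
  have hsum : ∑ j, χ j = 0 := MulChar.sum_eq_zero_of_ne_one hne
  refine DirichletCharacter.LFunction_apply_one_ne_zero hne ?_
  rw [DirichletCharacter.LFunction, ZMod.LFunction_def_odd hodd]
  have hterm : ∀ j, χ j * HurwitzZeta.hurwitzZetaOdd (ZMod.toAddCircle j) 1 =
      Real.pi * Complex.I / 2 * (χ j + 2 * (χ j * (ZMod.stdAddChar j - 1)⁻¹)) := by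
    intro j
    rcases eq_or_ne j 0 with rfl | hj
    · simp [hodd.map_zero]
    · rw [hurwitzZetaOdd_toAddCircle_one hj]
      ring
  simp_rw [hterm]
  rw [← Finset.mul_sum, Finset.sum_add_distrib, ← Finset.mul_sum, h, hsum]
  simp

/-- Expansion of `1 / (ψ x - 1)` in terms of the values of the additive character `ψ`. -/
lemma ZMod.inv_stdAddChar_sub_one {N : ℕ} [NeZero N] {x : ZMod N} (hx : x ≠ 0) :
    (ZMod.stdAddChar x - 1 : ℂ)⁻¹ = ∑ j : ZMod N, (j.val / N : ℂ) * ZMod.stdAddChar (j * x) := by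
  have hN : (N : ℂ) ≠ 0 := Nat.cast_ne_zero.2 (NeZero.ne N)
  have h1 : (ZMod.stdAddChar x : ℂ) - 1 ≠ 0 := sub_ne_zero.2 (ZMod.stdAddChar_ne_one hx)
  have hpow : (ZMod.stdAddChar x : ℂ) ^ N = 1 := by
    rw [← AddChar.map_nsmul_eq_pow]
    simp
  have hgen : ∀ (z : ℂ) (n : ℕ), (z - 1) * ∑ i ∈ Finset.range n, (i : ℂ) * z ^ i =
      n * z ^ n - ∑ i ∈ Finset.range n, z ^ (i + 1) := by
    intro z n
    induction n with
    | zero => simp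
    | succ n ih =>
      rw [Finset.sum_range_succ, mul_add, ih, Finset.sum_range_succ]
      push_cast
      ring
  have hgeom : ∑ i ∈ Finset.range N, (ZMod.stdAddChar x : ℂ) ^ (i + 1) = 0 := by
    have := mul_geom_sum (ZMod.stdAddChar x : ℂ) N
    rw [hpow, sub_self] at this
    simp_rw [pow_succ]
    rw [← Finset.sum_mul, (mul_eq_zero.1 this).resolve_left h1, zero_mul]
  have hre : ∑ j : ZMod N, (j.val / N : ℂ) * ZMod.stdAddChar (j * x) =
      (∑ i ∈ Finset.range N, (i : ℂ) * (ZMod.stdAddChar x : ℂ) ^ i) / N := by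
    rw [Finset.sum_div]
    refine Finset.sum_bij (fun j _ ↦ j.val) ?_ ?_ ?_ ?_
    · exact fun j _ ↦ Finset.mem_range.2 (ZMod.val_lt j)
    · exact fun a _ b _ h ↦ ZMod.val_injective N h
    · exact fun b hb ↦ ⟨b, Finset.mem_univ _, ZMod.val_cast_of_lt (Finset.mem_range.1 hb)⟩
    · intro j _
      rw [← AddChar.map_nsmul_eq_pow, nsmul_eq_mul, ZMod.natCast_zmod_val]
      ring
  rw [hre, eq_div_iff hN, inv_mul_eq_iff_eq_mul₀ h1, hgen, hpow, hgeom]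
  simp

/-- For `p` prime, a rational relation between the `p`-th roots of unity has constant
coefficients. -/
lemma ZMod.eq_of_sum_mul_stdAddChar_eq_zero {p : ℕ} [Fact p.Prime] {α : ZMod p → ℚ}
    (h : ∑ m, (α m : ℂ) * ZMod.stdAddChar m = 0) (m n : ZMod p) : α m = α n := by
  have hp : p.Prime := Fact.out
  have hζ := Complex.isPrimitiveRoot_exp p hp.ne_zero
  have h2 : ∑ i : Fin p, ((α ((i : ℕ) : ZMod p) : ℚ) : ℂ) *
      Complex.exp (2 * Real.pi * Complex.I / p) ^ (i : ℕ) = 0 := by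
    rw [← h]
    symm
    refine Finset.sum_bij (fun j _ ↦ (⟨j.val, ZMod.val_lt j⟩ : Fin p)) ?_ ?_ ?_ ?_
    · simp
    · intro a _ b _ h
      exact ZMod.val_injective p (Fin.mk.inj_iff.1 h)
    · exact fun b _ ↦ ⟨((b : ℕ) : ZMod p), Finset.mem_univ _, Fin.ext (ZMod.val_cast_of_lt b.2)⟩
    · intro j _
      simp only [ZMod.natCast_zmod_val]
      rw [ZMod.stdAddChar_apply_eq_exp, ← Complex.exp_nat_mul]
      push_cast
      ring_nf
  have h3 := (hζ.sum_eq_zero_iff_forall_eq hp (fun i ↦ α ((i : ℕ) : ZMod p))).1 h2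
    ⟨m.val, ZMod.val_lt m⟩ ⟨n.val, ZMod.val_lt n⟩
  simpa using h3

/-- A rational relation between the values `1 / (ψ x - 1)` is stable under the Galois action. -/
lemma ZMod.sum_mul_inv_stdAddChar_mul_sub_one_eq_zero {p : ℕ} [Fact p.Prime] {e : ZMod p → ℚ}
    (h0 : e 0 = 0) (h : ∑ x, (e x : ℂ) * (ZMod.stdAddChar x - 1)⁻¹ = 0) {b : ZMod p}
    (hb : b ≠ 0) : ∑ x, (e x : ℂ) * (ZMod.stdAddChar (b * x) - 1)⁻¹ = 0 := by
  set α : ZMod p → ℚ := fun m ↦ ∑ x, e x * ((m * x⁻¹).val / p) with hα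
  have key : ∀ c : ZMod p, c ≠ 0 → ∑ x, (e x : ℂ) * (ZMod.stdAddChar (c * x) - 1)⁻¹ =
      ∑ m, (α m : ℂ) * ZMod.stdAddChar (c * m) := by
    intro c hc
    simp only [hα]
    push_cast
    simp_rw [Finset.sum_mul]
    rw [Finset.sum_comm]
    refine Finset.sum_congr rfl fun x _ ↦ ?_
    rcases eq_or_ne x 0 with rfl | hx
    · simp [h0]
    rw [ZMod.inv_stdAddChar_sub_one (mul_ne_zero hc hx), Finset.mul_sum,
      ← Equiv.sum_comp (Equiv.mulRight₀ x⁻¹ (inv_ne_zero hx))]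
    refine Finset.sum_congr rfl fun m _ ↦ ?_
    simp only [Equiv.mulRight₀_apply]
    rw [show m * x⁻¹ * (c * x) = c * m by field_simp]
    ring
  have h1 := key 1 one_ne_zero
  simp only [one_mul] at h1
  rw [h] at h1
  have hconst := ZMod.eq_of_sum_mul_stdAddChar_eq_zero h1.symm
  have hz : ∀ m, α m = 0 := fun m ↦ (hconst m 0).trans (by simp [hα])
  rw [key b hb]
  simp [hz]

/-- A function on `ZMod p` orthogonal to all Dirichlet characters vanishes off `0`. -/
lemma ZMod.eq_zero_of_sum_dirichletCharacter_eq_zero {p : ℕ} [Fact p.Prime] {e : ZMod p → ℂ}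
    (h0 : e 0 = 0) (h : ∀ χ : DirichletCharacter ℂ p, ∑ x, e x * χ x = 0) : e = 0 := by
  have hp : p.Prime := Fact.out
  funext a
  rcases eq_or_ne a 0 with rfl | ha
  · exact h0
  have hz : ∑ x, e x * ∑ χ : DirichletCharacter ℂ p, χ a⁻¹ * χ x = 0 := by
    simp_rw [Finset.mul_sum]
    rw [Finset.sum_comm]
    refine Finset.sum_eq_zero fun χ _ ↦ ?_
    rw [← mul_zero (χ a⁻¹), ← h χ, Finset.mul_sum]
    exact Finset.sum_congr rfl fun x _ ↦ by ring
  simp_rw [DirichletCharacter.sum_char_inv_mul_char_eq ℂ (isUnit_iff_ne_zero.2 ha)] at hz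
  have ht : (p.totient : ℂ) ≠ 0 := Nat.cast_ne_zero.2 (Nat.totient_pos.2 hp.pos).ne'
  simpa [ht, hp.ne_one] using hz

/-- There are no rational relations between the values `1 / (ψ x - 1)` with odd coefficients. -/
lemma ZMod.eq_zero_of_odd_of_sum_mul_inv_stdAddChar_sub_one {p : ℕ} [Fact p.Prime]
    {e : ZMod p → ℚ} (he : Function.Odd e)
    (h : ∑ x, (e x : ℂ) * (ZMod.stdAddChar x - 1)⁻¹ = 0) : e = 0 := by
  have h0 : e 0 = 0 := he.map_zero
  suffices hc : (fun x ↦ (e x : ℂ)) = 0 by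
    funext x
    simpa using congrFun hc x
  refine ZMod.eq_zero_of_sum_dirichletCharacter_eq_zero (by simp [h0]) fun χ ↦ ?_
  rcases χ.even_or_odd with hχ | hχ
  · have : ∑ x, (e x : ℂ) * χ x = ∑ x, -((e x : ℂ) * χ x) := by
      rw [← Equiv.sum_comp (Equiv.neg (ZMod p))]
      refine Finset.sum_congr rfl fun x _ ↦ ?_
      simp [he x, hχ.eval_neg]
    rw [Finset.sum_neg_distrib] at this
    exact self_eq_neg.1 this
  · have hχ' : χ⁻¹.Odd := by
      have h1 : χ (-1) = -1 := hχ
      have h2 : (χ⁻¹ * χ) (-1) = 1 := by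
        rw [inv_mul_cancel, MulChar.one_apply isUnit_one.neg]
      rw [MulChar.mul_apply, h1] at h2
      change χ⁻¹ (-1) = -1
      linear_combination -h2
    refine (mul_eq_zero.1 ?_).resolve_right hχ'.sum_mul_inv_stdAddChar_sub_one_ne_zero
    have hz : ∑ b : ZMod p, χ⁻¹ b * ∑ x, (e x : ℂ) * (ZMod.stdAddChar (b * x) - 1)⁻¹ = 0 := by
      refine Finset.sum_eq_zero fun b _ ↦ ?_
      rcases eq_or_ne b 0 with rfl | hb
      · simp
      · rw [ZMod.sum_mul_inv_stdAddChar_mul_sub_one_eq_zero h0 h hb, mul_zero]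
    rw [← hz, Finset.sum_mul]
    simp_rw [Finset.mul_sum]
    rw [Finset.sum_comm (s := Finset.univ) (t := Finset.univ)
      (f := fun b x ↦ χ⁻¹ b * ((e x : ℂ) * (ZMod.stdAddChar (b * x) - 1)⁻¹))]
    refine Finset.sum_congr rfl fun x _ ↦ ?_
    rcases eq_or_ne x 0 with rfl | hx
    · simp [h0]
    rw [← Equiv.sum_comp (Equiv.mulRight₀ x hx)]
    refine Finset.sum_congr rfl fun b _ ↦ ?_
    have hxx : χ x * χ⁻¹ x = 1 := by
      rw [← MulChar.mul_apply, mul_inv_cancel, MulChar.one_apply (isUnit_iff_ne_zero.2 hx)]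
    simp only [Equiv.mulRight₀_apply, map_mul]
    linear_combination (e x : ℂ) * χ⁻¹ b * (ZMod.stdAddChar (b * x) - 1)⁻¹ * hxx

/-- The integers `1, …, (N - 1) / 2` are representatives of the nonzero classes up to sign. -/
lemma ZMod.exists_fin_eq_or_eq_neg {N : ℕ} [NeZero N] (hN : Odd N) {x : ZMod N} (hx : x ≠ 0) :
    ∃ k : Fin ((N - 1) / 2), x = (k : ZMod N) + 1 ∨ x = -((k : ZMod N) + 1) := by
  obtain ⟨n, hn⟩ := hN
  have h0 : x.val ≠ 0 := (ZMod.val_ne_zero x).2 hx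
  have hlt : x.val < N := x.val_lt
  by_cases h : x.val ≤ n
  · refine ⟨⟨x.val - 1, by omega⟩, Or.inl ?_⟩
    rw [← Nat.cast_succ, Nat.succ_eq_add_one, Nat.sub_add_cancel (by omega),
      ZMod.natCast_zmod_val]
  · refine ⟨⟨N - x.val - 1, by omega⟩, Or.inr ?_⟩
    rw [← Nat.cast_succ, Nat.succ_eq_add_one, Nat.sub_add_cancel (by omega),
      Nat.cast_sub hlt.le, ZMod.natCast_zmod_val]
    simp

lemma ZMod.fin_add_one_ne_zero {N : ℕ} (k : Fin ((N - 1) / 2)) : (k : ZMod N) + 1 ≠ 0 := by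
  have hk := k.2
  rw [← Nat.cast_succ, Ne, ZMod.natCast_eq_zero_iff]
  exact Nat.not_dvd_of_pos_of_lt (Nat.succ_pos _) (by omega)

lemma ZMod.val_fin_add_one {N : ℕ} (k : Fin ((N - 1) / 2)) :
    ((k : ZMod N) + 1).val = (k : ℕ) + 1 := by
  have hk := k.2
  rw [← Nat.cast_succ, ZMod.val_cast_of_lt (by omega)]

/-- The sum of an even function over the nonzero classes is twice its sum over half of them. -/
lemma ZMod.sum_eq_two_mul_sum_fin {N : ℕ} [NeZero N] (hN : Odd N) {F : ZMod N → ℂ}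
    (hF : Function.Even F) (h0 : F 0 = 0) :
    ∑ x, F x = 2 * ∑ k : Fin ((N - 1) / 2), F ((k : ZMod N) + 1) := by
  obtain ⟨n, hn⟩ := hN
  have h1 : ∑ x, F x = ∑ i ∈ Finset.range (n + n + 1), F (i : ZMod N) := by
    refine Finset.sum_bij (fun j _ ↦ j.val) ?_ ?_ ?_ ?_
    · intro j _
      have := j.val_lt
      exact Finset.mem_range.2 (by omega)
    · exact fun a _ b _ h ↦ ZMod.val_injective N h
    · intro b hb
      have := Finset.mem_range.1 hb
      exact ⟨b, Finset.mem_univ _, ZMod.val_cast_of_lt (by omega)⟩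
    · simp
  have h2 : ∑ i ∈ Finset.range n, F ((n + i + 1 : ℕ) : ZMod N) =
      ∑ i ∈ Finset.range n, F ((i + 1 : ℕ) : ZMod N) := by
    rw [← Finset.sum_range_reflect]
    refine Finset.sum_congr rfl fun i hi ↦ ?_
    have := Finset.mem_range.1 hi
    rw [← hF, show n + (n - 1 - i) + 1 = N - (i + 1) by omega, Nat.cast_sub (by omega)]
    simp
  rw [h1, Finset.sum_range_succ', Finset.sum_range_add, h2, Nat.cast_zero, h0,
    show (N - 1) / 2 = n by omega, ← two_mul, add_zero,
    Finset.sum_range (fun i ↦ F ((i + 1 : ℕ) : ZMod N))]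
  simp

/-- Every function on `{1, …, (N - 1) / 2}` extends to an odd function on `ZMod N`. -/
lemma ZMod.exists_odd_extension {N : ℕ} [NeZero N] (hN : Odd N) (a : Fin ((N - 1) / 2) → ℚ) :
    ∃ A : ZMod N → ℚ, Function.Odd A ∧
      ∀ k : Fin ((N - 1) / 2), A ((k : ZMod N) + 1) = a k := by
  obtain ⟨n, hn⟩ := hN
  refine ⟨fun x ↦ (x.valMinAbs.sign : ℚ) * if h : x.valMinAbs.natAbs - 1 < (N - 1) / 2 then
    a ⟨x.valMinAbs.natAbs - 1, h⟩ else 0, fun x ↦ ?_, fun k ↦ ?_⟩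
  · have hneg : (-x).valMinAbs = -x.valMinAbs :=
      ZMod.valMinAbs_neg_of_ne_half (by omega)
    simp only [hneg, Int.natAbs_neg, Int.sign_neg]
    push_cast
    ring
  · have hk := k.2
    have hv : ((k : ZMod N) + 1).valMinAbs = ((k + 1 : ℕ) : ℤ) := by
      rw [← Nat.cast_succ]
      exact ZMod.valMinAbs_natCast_of_le_half (by omega)
    have habs : ((k : ℤ) + 1).natAbs - 1 = k := by omega
    have hsign : ((k : ℤ) + 1).sign = 1 := Int.sign_eq_one_of_pos (by omega)
    push_cast at hv
    simp [hv, habs, hsign]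

lemma Function.Odd.eq_zero_of_forall_fin {N : ℕ} [NeZero N] (hN : _root_.Odd N) {A : ZMod N → ℚ}
    (hA : Function.Odd A) (h : ∀ k : Fin ((N - 1) / 2), A ((k : ZMod N) + 1) = 0) : A = 0 := by
  funext x
  rcases eq_or_ne x 0 with rfl | hx
  · exact hA.map_zero
  · obtain ⟨k, rfl | rfl⟩ := ZMod.exists_fin_eq_or_eq_neg hN hx
    · exact h k
    · rw [hA, h k]
      simp

/-- Cosecant values in terms of the standard additive character. -/
lemma inv_sin_eq_stdAddChar {N : ℕ} [NeZero N] (hN : Odd N) {x : ZMod N} (hx : x ≠ 0) :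
    (((Real.sin (2 * Real.pi * x.val / N))⁻¹ : ℝ) : ℂ) =
      2 * Complex.I * ((ZMod.stdAddChar x - 1)⁻¹ - (ZMod.stdAddChar (2 * x) - 1)⁻¹) := by
  have h2x : 2 * x ≠ 0 := by
    have hu : IsUnit (2 : ZMod N) := by
      have := (ZMod.isUnit_iff_coprime 2 N).2 (Nat.coprime_two_left.2 hN)
      exact_mod_cast this
    exact fun h ↦ hx (hu.mul_right_eq_zero.1 h)
  have h1 := sub_ne_zero.2 (ZMod.stdAddChar_ne_one hx)
  have h2 := sub_ne_zero.2 (ZMod.stdAddChar_ne_one h2x)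
  rw [two_mul x, AddChar.map_add_eq_mul] at h2 ⊢
  have hz : (ZMod.stdAddChar x : ℂ) ≠ 0 := by
    rw [ZMod.stdAddChar_apply_eq_exp]
    exact Complex.exp_ne_zero _
  have hsin : ((Real.sin (2 * Real.pi * x.val / N) : ℝ) : ℂ) =
      ((ZMod.stdAddChar x)⁻¹ - ZMod.stdAddChar x) * Complex.I / 2 := by
    rw [Complex.ofReal_sin, Complex.sin, ZMod.stdAddChar_apply_eq_exp, ← Complex.exp_neg]
    push_cast
    ring_nf
  have h3 : (ZMod.stdAddChar x : ℂ)⁻¹ - ZMod.stdAddChar x ≠ 0 := by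
    intro h
    apply h2
    field_simp at h
    linear_combination -h
  rw [Complex.ofReal_inv, hsin]
  have hI := Complex.I_ne_zero
  refine inv_eq_of_mul_eq_one_right ?_
  generalize (ZMod.stdAddChar x : ℂ) = z at *
  have h4 : z ^ 2 - 1 ≠ 0 := by rwa [sq]
  rw [← sq]
  field_simp
  ring_nf
  simp only [Complex.I_sq]
  ring

lemma cscRelationMap_eq_sum {p : ℕ} [Fact p.Prime] (hodd : Odd p) {A : ZMod p → ℚ}
    (hA : Function.Odd A) :
    ((cscRelationMap p (fun k ↦ A ((k : ZMod p) + 1)) : ℝ) : ℂ) =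
      Complex.I * ∑ x, ((A x - A (2⁻¹ * x) : ℚ) : ℂ) * (ZMod.stdAddChar x - 1)⁻¹ := by
  have h2 : (2 : ZMod p) ≠ 0 := by
    have := (ZMod.isUnit_iff_coprime 2 p).2 (Nat.coprime_two_left.2 hodd)
    exact_mod_cast this.ne_zero
  set F : ZMod p → ℂ := fun x ↦ (A x : ℂ) * ((ZMod.stdAddChar x - 1)⁻¹ -
    (ZMod.stdAddChar (2 * x) - 1)⁻¹) with hFdef
  have hF0 : F 0 = 0 := by simp [hFdef]
  have hFe : Function.Even F := by
    intro x
    rcases eq_or_ne x 0 with rfl | hx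
    · simp
    have e1 := inv_sin_eq_stdAddChar hodd hx
    have e2 := inv_sin_eq_stdAddChar hodd (neg_ne_zero.2 hx)
    have hs : Real.sin (2 * Real.pi * (-x).val / p) = -Real.sin (2 * Real.pi * x.val / p) := by
      have hp0 : (p : ℝ) ≠ 0 := Nat.cast_ne_zero.2 (NeZero.ne p)
      have : NeZero x := ⟨hx⟩
      rw [ZMod.val_neg_of_ne_zero, Nat.cast_sub x.val_lt.le, ← Real.sin_two_pi_sub]
      congr 1
      field_simp
    rw [hs, inv_neg, Complex.ofReal_neg, e1] at e2
    have hI := Complex.I_ne_zero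
    have e3 := mul_left_cancel₀ (mul_ne_zero two_ne_zero hI) ((mul_neg _ _).trans e2)
    simp only [hFdef]
    rw [← e3, hA x]
    push_cast
    ring
  have hsum := ZMod.sum_eq_two_mul_sum_fin hodd hFe hF0
  have hL : ((cscRelationMap p (fun k ↦ A ((k : ZMod p) + 1)) : ℝ) : ℂ) =
      Complex.I * ∑ x, F x := by
    rw [hsum]
    simp only [cscRelationMap, LinearMap.coe_sum, Finset.sum_apply, LinearMap.smul_apply,
      LinearMap.comp_apply, LinearMap.proj_apply, Algebra.linearMap_apply, smul_eq_mul,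
      Complex.ofReal_sum, Finset.mul_sum]
    refine Finset.sum_congr rfl fun k _ ↦ ?_
    have e := inv_sin_eq_stdAddChar hodd (ZMod.fin_add_one_ne_zero k)
    rw [ZMod.val_fin_add_one] at e
    push_cast at e ⊢
    rw [e]
    simp only [hFdef, eq_ratCast, Complex.ofReal_ratCast]
    ring
  rw [hL]
  congr 1
  have hsub : ∑ x, (A x : ℂ) * (ZMod.stdAddChar (2 * x) - 1)⁻¹ =
      ∑ x, (A (2⁻¹ * x) : ℂ) * (ZMod.stdAddChar x - 1)⁻¹ := by
    rw [← Equiv.sum_comp (Equiv.mulLeft₀ 2 h2)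
      (fun x ↦ (A (2⁻¹ * x) : ℂ) * (ZMod.stdAddChar x - 1)⁻¹)]
    refine Finset.sum_congr rfl fun x _ ↦ ?_
    simp [inv_mul_cancel_left₀ h2]
  simp only [hFdef, mul_sub, Finset.sum_sub_distrib, hsub]
  push_cast
  simp only [sub_mul, Finset.sum_sub_distrib]

/-- The relations between cosecant values correspond to the odd functions on `ZMod p` that are
invariant under multiplication by `2`. -/
lemma cscRelationMap_eq_zero_iff {p : ℕ} [Fact p.Prime] (hodd : Odd p) {A : ZMod p → ℚ}
    (hA : Function.Odd A) :
    cscRelationMap p (fun k ↦ A ((k : ZMod p) + 1)) = 0 ↔ ∀ x, A (2 * x) = A x := by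
  have h2 : (2 : ZMod p) ≠ 0 := by
    have := (ZMod.isUnit_iff_coprime 2 p).2 (Nat.coprime_two_left.2 hodd)
    exact_mod_cast this.ne_zero
  rw [← Complex.ofReal_eq_zero, cscRelationMap_eq_sum hodd hA, mul_eq_zero,
    or_iff_right Complex.I_ne_zero]
  constructor
  · intro h x
    have := congrFun (ZMod.eq_zero_of_odd_of_sum_mul_inv_stdAddChar_sub_one
      (e := fun x ↦ A x - A (2⁻¹ * x)) (fun x ↦ by simp only [mul_neg, hA _]; ring) h) (2 * x)
    simpa [inv_mul_cancel_left₀ h2, sub_eq_zero] using this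
  · intro h
    refine Finset.sum_eq_zero fun x _ ↦ ?_
    rw [← h (2⁻¹ * x), mul_inv_cancel_left₀ h2]
    simp

section InvariantFunctions

variable {p : ℕ} [Fact p.Prime]

/-- The sign of the absolutely least residue of `x ^ t`. -/
noncomputable def powSign (p t : ℕ) (x : ZMod p) : ℚ := ((x ^ t).valMinAbs.sign : ℚ)

lemma powSign_ne_zero (t : ℕ) {x : ZMod p} (hx : x ≠ 0) : powSign p t x ≠ 0 := by
  simp [powSign, Int.sign_eq_zero_iff_zero, hx]

lemma powSign_mul_self (t : ℕ) {x : ZMod p} (hx : x ≠ 0) :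
    powSign p t x * powSign p t x = 1 := by
  have h : (x ^ t).valMinAbs ≠ 0 := by simp [hx]
  rcases lt_or_gt_of_ne h with h | h
  · simp [powSign, Int.sign_eq_neg_one_of_neg h]
  · simp [powSign, Int.sign_eq_one_of_pos h]

lemma powSign_neg (hodd : Odd p) {t : ℕ} (ht : Odd t) (x : ZMod p) :
    powSign p t (-x) = -powSign p t x := by
  obtain ⟨n, hn⟩ := hodd
  rw [powSign, ht.neg_pow, ZMod.valMinAbs_neg_of_ne_half (by omega), Int.sign_neg, Int.cast_neg,
    powSign]

lemma powSign_mul {t : ℕ} {u : ZMod p} (hu : u ^ t = 1) (x : ZMod p) :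
    powSign p t (u * x) = powSign p t x := by
  rw [powSign, mul_pow, hu, one_mul, powSign]

/-- Twist a function on a quotient of `(ZMod p)ˣ` by `powSign` and extend it by zero. -/
noncomputable def twistedLift (t : ℕ) (H : Subgroup (ZMod p)ˣ) :
    ((ZMod p)ˣ ⧸ H → ℚ) →ₗ[ℚ] (ZMod p → ℚ) where
  toFun c x := if h : x = 0 then 0 else powSign p t x * c (Units.mk0 x h : (ZMod p)ˣ)
  map_add' c d := by
    ext x
    by_cases h : x = 0 <;> simp [h, mul_add]
  map_smul' r c := by
    ext x
    by_cases h : x = 0 <;> simp [h, mul_left_comm]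

lemma twistedLift_apply (t : ℕ) (H : Subgroup (ZMod p)ˣ) (c : (ZMod p)ˣ ⧸ H → ℚ)
    (g : (ZMod p)ˣ) : twistedLift t H c g = powSign p t g * c g := by
  simp [twistedLift]

lemma twistedLift_zero (t : ℕ) (H : Subgroup (ZMod p)ˣ) (c : (ZMod p)ˣ ⧸ H → ℚ) :
    twistedLift t H c 0 = 0 := by
  simp [twistedLift]

lemma twistedLift_injective (t : ℕ) (H : Subgroup (ZMod p)ˣ) :
    Function.Injective (twistedLift t H) := by
  intro c d hcd
  funext q
  induction q using QuotientGroup.induction_on with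
  | H g =>
    have := congrFun hcd g
    rw [twistedLift_apply, twistedLift_apply] at this
    exact mul_left_cancel₀ (powSign_ne_zero t g.ne_zero) this

lemma twistedLift_odd (hodd : Odd p) {t : ℕ} (ht : Odd t) {H : Subgroup (ZMod p)ˣ}
    (hH : -1 ∈ H) (c : (ZMod p)ˣ ⧸ H → ℚ) : Function.Odd (twistedLift t H c) := by
  intro x
  rcases eq_or_ne x 0 with rfl | hx
  · simp [twistedLift_zero]
  lift x to (ZMod p)ˣ using hx.isUnit
  have hq : ((-x : (ZMod p)ˣ) : (ZMod p)ˣ ⧸ H) = x := by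
    rw [QuotientGroup.eq]
    simpa using hH
  rw [← Units.val_neg, twistedLift_apply, twistedLift_apply, hq, Units.val_neg,
    powSign_neg hodd ht, neg_mul]

lemma twistedLift_mul {t : ℕ} {H : Subgroup (ZMod p)ˣ} {u : (ZMod p)ˣ} (hu : u ∈ H)
    (hut : (u : ZMod p) ^ t = 1) (c : (ZMod p)ˣ ⧸ H → ℚ) (x : ZMod p) :
    twistedLift t H c (u * x) = twistedLift t H c x := by
  rcases eq_or_ne x 0 with rfl | hx
  · simp
  lift x to (ZMod p)ˣ using hx.isUnit
  have hq : ((u * x : (ZMod p)ˣ) : (ZMod p)ˣ ⧸ H) = x := by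
    rw [QuotientGroup.eq]
    simpa using hu
  rw [← Units.val_mul, twistedLift_apply, twistedLift_apply, hq, Units.val_mul,
    powSign_mul hut]

lemma exists_twistedLift_eq (t : ℕ) (u : (ZMod p)ˣ) {A : ZMod p → ℚ} (h0 : A 0 = 0)
    (hA : ∀ x, powSign p t (u * x) * A (u * x) = powSign p t x * A x) :
    ∃ c, twistedLift t (Subgroup.zpowers u) c = A := by
  have hpow : ∀ (n : ℕ) (g : (ZMod p)ˣ), powSign p t (u ^ n * g : (ZMod p)ˣ) *
      A (u ^ n * g : (ZMod p)ˣ) = powSign p t g * A g := by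
    intro n g
    induction n with
    | zero => simp
    | succ n ih =>
      rw [pow_succ', mul_assoc, Units.val_mul, hA, ih]
  refine ⟨fun q ↦ powSign p t q.out * A q.out, ?_⟩
  funext x
  rcases eq_or_ne x 0 with rfl | hx
  · rw [twistedLift_zero, h0]
  lift x to (ZMod p)ˣ using hx.isUnit
  obtain ⟨⟨h, hh⟩, hout⟩ := QuotientGroup.mk_out_eq_mul (Subgroup.zpowers u) x
  rw [← mem_powers_iff_mem_zpowers] at hh
  obtain ⟨n, rfl⟩ := hh
  rw [twistedLift_apply, hout, mul_comm x, hpow, ← mul_assoc, powSign_mul_self t hx, one_mul]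

end InvariantFunctions

lemma orderOf_neg_two {p : ℕ} [Fact p.Prime] (hodd : Odd p)
    (h : Odd (orderOf (2 : ZMod p))) : orderOf (-2 : ZMod p) = 2 * orderOf (2 : ZMod p) := by
  have h1 : orderOf (-1 : ZMod p) = 2 := by
    rw [orderOf_neg_one, ZMod.ringChar_zmod_n, if_neg]
    rintro rfl
    exact absurd hodd (by decide)
  rw [← neg_one_mul, (Commute.all _ _).orderOf_mul_eq_mul_orderOf_of_coprime, h1]
  rw [h1]
  exact Nat.coprime_two_left.2 h

/-- Let `p` be an odd prime and suppose the multiplicative order `t` of `2` in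
`(ℤ/pℤ)ˣ` is odd.  Then the space of rational linear relations among the values
`csc(2πk/p)`, `k = 1, …, (p-1)/2`, has ℚ-dimension exactly `(p-1)/(2t)`. -/
theorem dim_csc_relation_space_of_odd_order (p : ℕ) (hp : p.Prime) (hodd : Odd p)
    (t : ℕ) (ht : t = orderOf (2 : ZMod p)) (htodd : Odd t) :
    Module.finrank ℚ (LinearMap.ker (cscRelationMap p)) = (p - 1) / (2 * t) := by
  have : Fact p.Prime := ⟨hp⟩
  have h2 : (2 : ZMod p) ≠ 0 := by
    have := (ZMod.isUnit_iff_coprime 2 p).2 (Nat.coprime_two_left.2 hodd)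
    exact_mod_cast this.ne_zero
  have h2t : (2 : ZMod p) ^ t = 1 := ht ▸ pow_orderOf_eq_one _
  set v : (ZMod p)ˣ := Units.mk0 2 h2 with hv
  set H : Subgroup (ZMod p)ˣ := Subgroup.zpowers (-v) with hH
  have hneg : -1 ∈ H := by
    refine ⟨t, ?_⟩
    ext
    simp [hv, htodd.neg_pow, h2t]
  have hvH : v ∈ H := by
    simpa using H.mul_mem hneg (Subgroup.mem_zpowers (-v))
  have hcard : Nat.card ((ZMod p)ˣ ⧸ H) = (p - 1) / (2 * t) := by
    have h1 := H.card_eq_card_quotient_mul_card_subgroup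
    rw [Nat.card_zpowers, ← orderOf_units, Units.val_neg, hv, Units.val_mk0,
      orderOf_neg_two hodd (ht ▸ htodd), ← ht, Nat.card_eq_fintype_card,
      ZMod.card_units] at h1
    rw [h1, Nat.mul_div_cancel _ (by have := htodd.pos; positivity)]
  let res : (ZMod p → ℚ) →ₗ[ℚ] (Fin ((p - 1) / 2) → ℚ) :=
    LinearMap.funLeft ℚ ℚ (fun k ↦ (k : ZMod p) + 1)
  have hodd' (c) := twistedLift_odd hodd htodd hneg c
  have hinj : Function.Injective (res ∘ₗ twistedLift t H) := by
    rw [injective_iff_map_eq_zero]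
    intro c hc
    apply twistedLift_injective t H
    rw [map_zero]
    exact (hodd' c).eq_zero_of_forall_fin hodd fun k ↦ congrFun hc k
  have hrange : LinearMap.range (res ∘ₗ twistedLift t H) = LinearMap.ker (cscRelationMap p) := by
    ext a
    constructor
    · rintro ⟨c, rfl⟩
      exact (cscRelationMap_eq_zero_iff hodd (hodd' c)).2 fun x ↦ twistedLift_mul hvH h2t c x
    · intro ha
      obtain ⟨A, hA, hAa⟩ := ZMod.exists_odd_extension hodd a
      obtain rfl : (fun k : Fin ((p - 1) / 2) ↦ A ((k : ZMod p) + 1)) = a := funext hAa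
      have hinv := (cscRelationMap_eq_zero_iff hodd hA).1 ha
      obtain ⟨c, hc⟩ := exists_twistedLift_eq t (-v) hA.map_zero (fun x ↦ by
        rw [Units.val_neg, hv, Units.val_mk0, neg_mul, powSign_neg hodd htodd, hA, hinv,
          powSign_mul h2t, neg_mul_neg])
      exact ⟨c, by rw [LinearMap.comp_apply, hc]; rfl⟩
  rw [← hrange, LinearMap.finrank_range_of_inj hinj, Module.finrank_fintype_fun_eq_card,
    ← Nat.card_eq_fintype_card, hcard]
end

section
/- Let p be an odd prime, let t be the multiplicative order of 2 in (ℤ/pℤ)^×, and let m be an integer not divisible by p. Then Σ_{j=1}^{t} csc(2π·2^j·m/p) = 0. -/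
/-- The sum of the cosecants of iterated doublings of `θ` telescopes to a difference of
cotangents. -/
theorem Real.sum_inv_sin_two_pow_mul (θ : ℝ) (t : ℕ)
    (h : ∀ j, Real.sin (2 ^ j * θ) ≠ 0) :
    ∑ j ∈ Finset.Icc 1 t, (Real.sin (2 ^ j * θ))⁻¹ = Real.cot θ - Real.cot (2 ^ t * θ) := by
  induction t with
  | zero => simp
  | succ n ih =>
    rw [Finset.sum_Icc_succ_top (by omega), ih]
    have hs := h n
    have hs' := h (n + 1)
    have e : (2 : ℝ) ^ (n + 1) * θ = 2 * (2 ^ n * θ) := by ring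
    rw [e] at hs' ⊢
    generalize 2 ^ n * θ = x at *
    rw [Real.cot_eq_cos_div_sin x, Real.cot_eq_cos_div_sin (2 * x)]
    rw [Real.sin_two_mul] at hs' ⊢
    have hc : Real.cos x ≠ 0 := right_ne_zero_of_mul hs'
    rw [Real.cos_two_mul]
    field_simp
    ring

/-- Let `p` be an odd prime, let `t` be the multiplicative order of `2` in
`(ℤ/pℤ)ˣ`, and let `m` be an integer not divisible by `p`.  Then
`Σ_{j=1}^{t} csc(2π·2^j·m/p) = 0`, where `csc x = (sin x)⁻¹`. -/
theorem sum_csc_doubling_orbit_eq_zero (p : ℕ) (hp : p.Prime) (hodd : Odd p)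
    (t : ℕ) (ht : t = orderOf (2 : ZMod p)) (m : ℤ) (hm : ¬ (p : ℤ) ∣ m) :
    ∑ j ∈ Finset.Icc 1 t,
      (Real.sin (2 * Real.pi * ((2 : ℝ) ^ j * (m : ℝ)) / p))⁻¹ = 0 := by
  have hp0 : (p : ℝ) ≠ 0 := by exact_mod_cast hp.ne_zero
  have hpZ : Prime (p : ℤ) := Nat.prime_iff_prime_int.mp hp
  have hp2 : ¬ (p : ℤ) ∣ 2 := by
    intro h
    have h2 : p ∣ 2 := by exact_mod_cast h
    rw [(Nat.prime_dvd_prime_iff_eq hp Nat.prime_two).mp h2] at hodd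
    exact absurd hodd (by decide)
  have hrw (j : ℕ) : 2 * Real.pi * ((2 : ℝ) ^ j * (m : ℝ)) / p
      = 2 ^ j * (2 * Real.pi * m / p) := by ring
  simp_rw [hrw]
  rw [Real.sum_inv_sin_two_pow_mul]
  · have hpow : (2 : ZMod p) ^ t = 1 := ht ▸ pow_orderOf_eq_one _
    obtain ⟨k, hk⟩ : (p : ℤ) ∣ 2 ^ t - 1 := by
      rw [← ZMod.intCast_zmod_eq_zero_iff_dvd]
      simp [hpow]
    have hk' : (2 : ℝ) ^ t = p * k + 1 := by
      have : (2 : ℝ) ^ t - 1 = p * k := by exact_mod_cast hk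
      linarith
    have e : (2 : ℝ) ^ t * (2 * Real.pi * m / p)
        = 2 * Real.pi * m / p + (k * m : ℤ) * (2 * Real.pi) := by
      rw [hk']
      push_cast
      field_simp
      ring
    rw [e, Real.cot_eq_cos_div_sin, Real.cot_eq_cos_div_sin, Real.cos_add_int_mul_two_pi,
      Real.sin_add_int_mul_two_pi, sub_self]
  · intro j hj
    obtain ⟨n, hn⟩ := Real.sin_eq_zero_iff.mp hj
    have h : (n : ℝ) * p = 2 ^ j * (2 * m) := by
      field_simp at hn
      linarith
    have h' : n * (p : ℤ) = 2 ^ j * (2 * m) := by exact_mod_cast h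
    have hd : (p : ℤ) ∣ 2 ^ j * (2 * m) := h' ▸ dvd_mul_left _ _
    rcases hpZ.dvd_or_dvd hd with h1 | h1
    · exact hp2 (hpZ.dvd_of_dvd_pow h1)
    · exact (hpZ.dvd_or_dvd h1).elim hp2 hm
end
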